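/- arXiv:1609.04477 — 2 statements merged into one kernel-verified Lean document; each statement's English description precedes it below -/
import Mathlib

section
/- For every integer r ≥ 1, the graph G_r (the join of the complete graph K_{r+2} with the disjoint union of r+1 copies of K_2, a graph on 3r+4 vertices) and the complete graph K_{3r+4} are equienergetic: the energy of G_r equals the energy of K_{3r+4}, namely E(G_r) = 2(3r+4) − 2 = 6r + 6. -/
open scoped Classical

/-- The real adjacency matrix of a finite simple graph is Hermitian (symmetric). -/
theorem adjMatrix_isHermitian {V : Type*} [Fintype V] (G : SimpleGraph V)
    [DecidableRel G.Adj] : (G.adjMatrix ℝ).IsHermitian := by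
  unfold Matrix.IsHermitian
  rw [Matrix.conjTranspose_eq_transpose_of_trivial]
  exact G.isSymm_adjMatrix

/-- The energy of a finite simple graph: the sum of the absolute values of the
eigenvalues of its real adjacency matrix, counted with multiplicity. -/
noncomputable def graphEnergy {V : Type*} [Fintype V] (G : SimpleGraph V) : ℝ :=
  ∑ v, |(adjMatrix_isHermitian G).eigenvalues v|

/-- `Gr r` is the join of `K_{r+2}` with the disjoint union of `r+1` copies of `K_2`:
two distinct vertices are adjacent iff at least one of them lies in the `K_{r+2}` part,
or both lie in the second part with the same first coordinate. -/
def Gr (r : ℕ) : SimpleGraph (Fin (r + 2) ⊕ Fin (r + 1) × Fin 2) :=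
  SimpleGraph.fromRel fun a b =>
    a.isLeft = true ∨ b.isLeft = true ∨
      ∃ (i : Fin (r + 1)) (j k : Fin 2), a = Sum.inr (i, j) ∧ b = Sum.inr (i, k)

open Matrix

/-- The sum of the absolute values of the eigenvalues of a Hermitian matrix `A` is the trace of
any positive semidefinite matrix with the same square as `A`. -/
theorem Matrix.IsHermitian.sum_abs_eigenvalues_eq_trace {n : Type*} [Fintype n] [DecidableEq n]
    {A B : Matrix n n ℝ} (hA : A.IsHermitian) (hB : B.PosSemidef) (h : B * B = A * A) :
    ∑ i, |hA.eigenvalues i| = B.trace := by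
  open scoped MatrixOrder in
  have hAB : cfc (fun x : ℝ => ‖x‖) A = B := by
    rw [← CFC.abs_eq_cfc_norm A hA.isSelfAdjoint]
    refine CFC.sqrt_unique ?_ hB.nonneg
    rw [h, hA.isSelfAdjoint.star_eq]
  rw [← hAB, hA.cfc_eq, Matrix.IsHermitian.cfc, Unitary.conjStarAlgAut_apply,
    Matrix.trace_mul_cycle]
  simp [Matrix.trace]

/-- If the square of the adjacency matrix of `G` is the square of
`1 + a • u uᵀ + b • w wᵀ` with `a, b ≥ 0` and `u ⟂ w`, then the energy of `G` is the trace of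
that matrix. -/
theorem graphEnergy_eq_of_adjMatrix_mul_self {V : Type*} [Fintype V] [DecidableEq V]
    (G : SimpleGraph V) [DecidableRel G.Adj] {u w : V → ℝ} {a b : ℝ} (ha : 0 ≤ a) (hb : 0 ≤ b)
    (huw : u ⬝ᵥ w = 0)
    (h : G.adjMatrix ℝ * G.adjMatrix ℝ = 1 + (a * (2 + a * (u ⬝ᵥ u))) • vecMulVec u u
      + (b * (2 + b * (w ⬝ᵥ w))) • vecMulVec w w) :
    graphEnergy G = Fintype.card V + a * (u ⬝ᵥ u) + b * (w ⬝ᵥ w) := by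
  have hB : (1 + a • vecMulVec u u + b • vecMulVec w w).PosSemidef :=
    (PosSemidef.one.add ((posSemidef_vecMulVec_self_star u).smul ha)).add
      ((posSemidef_vecMulVec_self_star w).smul hb)
  have hsq : (1 + a • vecMulVec u u + b • vecMulVec w w) *
      (1 + a • vecMulVec u u + b • vecMulVec w w) = G.adjMatrix ℝ * G.adjMatrix ℝ := by
    rw [h]
    simp only [add_mul, mul_add, smul_mul_assoc, mul_smul_comm, vecMulVec_mul_vecMulVec, huw,
      dotProduct_comm w u, one_mul, mul_one, zero_smul, vecMulVec_zero, smul_zero,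
      vecMulVec_smul]
    module
  have key := (adjMatrix_isHermitian G).sum_abs_eigenvalues_eq_trace hB (by convert hsq)
  simp only [trace_add, trace_smul, trace_vecMulVec, trace_one, smul_eq_mul] at key
  rw [← key]
  unfold graphEnergy
  congr!

/-- The energy of the complete graph on `n ≥ 2` vertices is `2 (n - 1)`. -/
theorem graphEnergy_completeGraph {n : ℕ} (hn : 2 ≤ n) :
    graphEnergy (SimpleGraph.completeGraph (Fin n)) = 2 * ((n : ℝ) - 1) := by
  have hn' : (2 : ℝ) ≤ n := by exact_mod_cast hn
  have hn0 : (n : ℝ) ≠ 0 := by positivity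
  have hA : (SimpleGraph.completeGraph (Fin n)).adjMatrix ℝ = vecMulVec 1 1 - 1 := by
    ext i j
    by_cases hij : i = j <;> simp [hij]
  rw [graphEnergy_eq_of_adjMatrix_mul_self (u := 1) (w := 0) (a := ((n : ℝ) - 2) / n) (b := 0)
    _ (div_nonneg (by linarith) (by linarith)) le_rfl (by simp)]
  · simp
    field_simp
    ring
  · have hc : ((n : ℝ) - 2) / n * (2 + ((n : ℝ) - 2) / n * n) = n - 2 := by
      field_simp
      ring
    simp only [hA, one_dotProduct_one, Fintype.card_fin, hc, sub_mul, mul_sub,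
      vecMulVec_mul_vecMulVec, vecMulVec_smul, zero_mul, zero_smul, one_mul, mul_one]
    module

/-- The adjacency matrix of `r + 1` disjoint copies of `K_2`. -/
def matchingMatrix (r : ℕ) : Matrix (Fin (r + 1) × Fin 2) (Fin (r + 1) × Fin 2) ℝ :=
  of fun p q => if p.1 = q.1 ∧ p.2 ≠ q.2 then 1 else 0

theorem Gr_adj_inr_inr {r : ℕ} (p q : Fin (r + 1) × Fin 2) :
    (Gr r).Adj (Sum.inr p) (Sum.inr q) ↔ p.1 = q.1 ∧ p.2 ≠ q.2 := by
  obtain ⟨i, j⟩ := p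
  obtain ⟨k, l⟩ := q
  simp only [Gr, SimpleGraph.fromRel_adj, Sum.isLeft_inr, Sum.inr.injEq, Prod.mk.injEq]
  grind

theorem Gr_adjMatrix (r : ℕ) : (Gr r).adjMatrix ℝ =
    fromBlocks (vecMulVec 1 1 - 1) (vecMulVec 1 1) (vecMulVec 1 1) (matchingMatrix r) := by
  ext a b
  rcases a with i | ⟨i, j⟩ <;> rcases b with k | ⟨k, l⟩
  · by_cases hik : i = k <;> simp [Gr, hik]
  · simp [Gr]
  · simp [Gr]
  · simp [Gr_adj_inr_inr, matchingMatrix]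

theorem matchingMatrix_mulVec_one (r : ℕ) : matchingMatrix r *ᵥ 1 = 1 := by
  ext ⟨i, j⟩
  simp only [mulVec, dotProduct, Fintype.sum_prod_type, Fin.sum_univ_two]
  fin_cases j <;> simp [matchingMatrix]

theorem one_vecMul_matchingMatrix (r : ℕ) : 1 ᵥ* matchingMatrix r = 1 := by
  ext ⟨i, j⟩
  simp only [vecMul, dotProduct, Fintype.sum_prod_type, Fin.sum_univ_two]
  fin_cases j <;> simp [matchingMatrix]

theorem matchingMatrix_mul_self (r : ℕ) : matchingMatrix r * matchingMatrix r = 1 := by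
  ext ⟨i, j⟩ ⟨k, l⟩
  by_cases hik : i = k <;> fin_cases j <;> fin_cases l <;>
    simp [matchingMatrix, mul_apply, Fintype.sum_prod_type, Matrix.one_apply, ite_and, hik]

theorem Gr_adjMatrix_mul_self (r : ℕ) : (Gr r).adjMatrix ℝ * (Gr r).adjMatrix ℝ =
    1 + fromBlocks ((3 * r + 2 : ℝ) • vecMulVec 1 1) ((r + 2 : ℝ) • vecMulVec 1 1)
      ((r + 2 : ℝ) • vecMulVec 1 1) ((r + 2 : ℝ) • vecMulVec 1 1) := by
  rw [Gr_adjMatrix, fromBlocks_multiply, ← fromBlocks_one, fromBlocks_add]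
  congr 1 <;>
  · simp only [Matrix.sub_mul, Matrix.mul_sub, vecMulVec_mul_vecMulVec, vecMulVec_smul,
      mul_vecMulVec (matchingMatrix r), vecMulVec_mul _ _ (matchingMatrix r),
      matchingMatrix_mulVec_one, one_vecMul_matchingMatrix,
      matchingMatrix_mul_self, Matrix.one_mul, Matrix.mul_one, one_dotProduct_one, Fintype.card_prod,
      Fintype.card_fin]
    push_cast
    module

theorem graphEnergy_Gr (r : ℕ) : graphEnergy (Gr r) = 6 * (r : ℝ) + 6 := by
  have h1 : (3 * r + 4 : ℝ) ≠ 0 := by positivity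
  have h2 : (r + 2 : ℝ) ≠ 0 := by positivity
  let u : Fin (r + 2) ⊕ Fin (r + 1) × Fin 2 → ℝ :=
    Sum.elim (fun _ => 2 * (r + 1)) (fun _ => r + 2)
  let w : Fin (r + 2) ⊕ Fin (r + 1) × Fin 2 → ℝ := Sum.elim (fun _ => 1) (fun _ => -1)
  have huu : u ⬝ᵥ u = 2 * (r + 1) * (r + 2) * (3 * r + 4) := by
    simp [u, dotProduct]
    ring
  have hww : w ⬝ᵥ w = 3 * r + 4 := by
    simp [w, dotProduct]
    ring
  have huw : u ⬝ᵥ w = 0 := by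
    simp [u, w, dotProduct]
    ring
  rw [graphEnergy_eq_of_adjMatrix_mul_self (Gr r) (u := u) (w := w)
    (a := 1 / ((r + 2) * (3 * r + 4))) (b := r / (3 * r + 4)) (by positivity) (by positivity) huw,
    huu, hww]
  · simp only [Fintype.card_sum, Fintype.card_prod, Fintype.card_fin]
    push_cast
    field_simp
    ring
  · rw [Gr_adjMatrix_mul_self, huu, hww, add_assoc]
    congr 1
    ext (i | i) (j | j) <;> simp [u, w, vecMulVec_apply] <;> field_simp <;> ring

/-- For every integer `r ≥ 1`, the cograph `G_r` and the complete graph `K_{3r+4}`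
are equienergetic, with common energy `2(3r+4) - 2 = 6r + 6`. -/
theorem Gr_equienergetic_complete (r : ℕ) (hr : 1 ≤ r) :
    graphEnergy (Gr r) = graphEnergy (SimpleGraph.completeGraph (Fin (3 * r + 4))) ∧
    graphEnergy (Gr r) = 6 * (r : ℝ) + 6 := by
  refine ⟨?_, graphEnergy_Gr r⟩
  rw [graphEnergy_Gr, graphEnergy_completeGraph (by omega)]
  push_cast
  ring
end

section
/- If G and H are nonempty cographs (each with at least one vertex), then the number of negative adjacency eigenvalues of the join G ⊗ H equals n_−(G) + n_−(H) + 1, where n_−(·) denotes the number of negative eigenvalues (with multiplicity) of the adjacency matrix; moreover n_−(G ∪ H) = n_−(G) + n_−(H) for the disjoint union. -/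
open scoped Classical

/-- A cograph is a finite simple graph with no induced path on four vertices. -/
def IsCograph {V : Type*} (G : SimpleGraph V) : Prop :=
  ¬ Nonempty (SimpleGraph.pathGraph 4 ↪g G)

/-- The number of negative adjacency eigenvalues of a graph, with multiplicity. -/
noncomputable def negCount {V : Type*} [Fintype V] (G : SimpleGraph V) : ℕ :=
  (Finset.univ.filter fun v => (adjMatrix_isHermitian G).eigenvalues v < 0).card

/-- The join of two graphs: all edges within each part, plus all edges between parts. -/
def graphJoin {α β : Type*} (G : SimpleGraph α) (H : SimpleGraph β) :
    SimpleGraph (α ⊕ β) where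
  Adj x y :=
    match x, y with
    | Sum.inl a, Sum.inl b => G.Adj a b
    | Sum.inr a, Sum.inr b => H.Adj a b
    | Sum.inl _, Sum.inr _ => True
    | Sum.inr _, Sum.inl _ => True
  symm := by
    refine ⟨?_⟩
    rintro (a | a) (b | b) h
    · exact G.adj_symm h
    · trivial
    · trivial
    · exact H.adj_symm h
  loopless := by
    refine ⟨?_⟩
    rintro (a | a) h
    · exact G.loopless.irrefl a h
    · exact H.loopless.irrefl a h

/-- The graph contains an induced path `a - b - c - d` on four vertices. -/
def HasInducedP4 {V : Type*} (G : SimpleGraph V) : Prop :=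
  ∃ a b c d, G.Adj a b ∧ G.Adj b c ∧ G.Adj c d ∧ Gᶜ.Adj a c ∧ Gᶜ.Adj a d ∧ Gᶜ.Adj b d

theorem hasInducedP4_compl {V : Type*} {G : SimpleGraph V} (h : HasInducedP4 Gᶜ) :
    HasInducedP4 G := by
  obtain ⟨a, b, c, d, hab, hbc, hcd, hac, had, hbd⟩ := h
  rw [compl_compl] at hac had hbd
  exact ⟨b, d, a, c, hbd, had.symm, hac, hab.symm, hbc, hcd.symm⟩

theorem IsCograph.not_hasInducedP4 {V : Type*} {G : SimpleGraph V} (h : IsCograph G) :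
    ¬ HasInducedP4 G := by
  rintro ⟨a, b, c, d, hab, hbc, hcd, hac, had, hbd⟩
  refine h ⟨⟨⟨![a, b, c, d], ?_⟩, ?_⟩⟩
  · have := hab.ne; have := hbc.ne; have := hcd.ne
    have := hac.ne; have := had.ne; have := hbd.ne
    intro i j hij
    fin_cases i <;> fin_cases j <;> simp_all
  · have := hab.symm; have := hbc.symm; have := hcd.symm
    have := hac.symm; have := had.symm; have := hbd.symm
    intro i j
    rw [SimpleGraph.compl_adj] at *
    change G.Adj (![a, b, c, d] i) (![a, b, c, d] j) ↔ _
    fin_cases i <;> fin_cases j <;> simp_all [SimpleGraph.pathGraph_adj]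

/-- `S` splits into two nonempty parts with no edges of `G` between them. -/
def Separated {V : Type*} (G : SimpleGraph V) (S : Finset V) : Prop :=
  ∃ A B : Finset V, A.Nonempty ∧ B.Nonempty ∧ Disjoint A B ∧ A ∪ B = S ∧
    ∀ a ∈ A, ∀ b ∈ B, ¬ G.Adj a b

theorem separated_of_subset {V : Type*} {G : SimpleGraph V} {S A : Finset V} (hAS : A ⊆ S)
    (hA : A.Nonempty) (hne : A ≠ S) (h : ∀ a ∈ A, ∀ b ∈ S, b ∉ A → ¬ G.Adj a b) :
    Separated G S := by
  refine ⟨A, S \ A, hA, ?_, Finset.disjoint_sdiff, Finset.union_sdiff_of_subset hAS, ?_⟩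
  · exact Finset.sdiff_nonempty.2 fun hSA => hne (hAS.antisymm hSA)
  · intro a ha b hb
    exact h a ha b (Finset.mem_sdiff.1 hb).1 (Finset.mem_sdiff.1 hb).2

/-- The case of `separated_insert_or_compl` in which the non-neighbour of `v` lies in `A`. -/
theorem separated_insert_of_nonadj {V : Type*} {G : SimpleGraph V} (hG : ¬ HasInducedP4 G)
    {A B : Finset V} {v w d : V} (hv : v ∉ A ∪ B) (hd : Disjoint A B)
    (hAB : ∀ a ∈ A, ∀ b ∈ B, ¬ G.Adj a b) (hw : w ∈ A) (hvw : ¬ G.Adj v w)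
    (hdB : d ∈ B) (hvd : G.Adj v d) : Separated G (insert v (A ∪ B)) := by
  have hdis := Finset.disjoint_left.1 hd
  refine separated_of_subset (A := A.filter fun a => ¬ G.Adj v a) ?_ ⟨w, by simp [hw, hvw]⟩ ?_ ?_
  · intro a ha
    simp_all
  · intro e
    have : v ∈ A.filter fun a => ¬ G.Adj v a := e ▸ Finset.mem_insert_self _ _
    exact hv (Finset.mem_union_left _ (Finset.mem_filter.1 this).1)
  · intro b hb a ha haA hba
    obtain ⟨hbA, hvb⟩ := Finset.mem_filter.1 hb
    rcases Finset.mem_insert.1 ha with rfl | ha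
    · exact hvb hba.symm
    rcases Finset.mem_union.1 ha with ha | ha
    · have hva : G.Adj v a := by
        by_contra hva
        exact haA (Finset.mem_filter.2 ⟨ha, hva⟩)
      refine hG ⟨d, v, a, b, hvd.symm, hva, hba.symm, ?_, ?_, ?_⟩ <;>
        rw [SimpleGraph.compl_adj]
      · exact ⟨fun e => hdis ha (e ▸ hdB), fun h => hAB a ha d hdB h.symm⟩
      · exact ⟨fun e => hdis hbA (e ▸ hdB), fun h => hAB b hbA d hdB h.symm⟩
      · exact ⟨fun e => hv (Finset.mem_union_left _ (e ▸ hbA)), hvb⟩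
    · exact hAB b hbA a ha hba

theorem separated_insert_or_compl {V : Type*} {G : SimpleGraph V} (hG : ¬ HasInducedP4 G)
    {S : Finset V} {v : V} (hv : v ∉ S) (hS : Separated G S) :
    Separated G (insert v S) ∨ Separated Gᶜ (insert v S) := by
  obtain ⟨A, B, hA, hB, hd, rfl, hAB⟩ := hS
  by_cases hall : ∀ w ∈ A ∪ B, G.Adj v w
  · refine Or.inr ⟨{v}, A ∪ B, by simp, hA.mono Finset.subset_union_left, by simpa using hv,
      rfl, ?_⟩
    intro a ha b hb
    rw [Finset.mem_singleton.1 ha, SimpleGraph.compl_adj]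
    exact fun h => h.2 (hall b hb)
  left
  push Not at hall
  obtain ⟨w, hw, hvw⟩ := hall
  have key : ∀ C D : Finset V, C.Nonempty → (∀ d ∈ C, ¬ G.Adj v d) → C ∪ D = A ∪ B →
      Disjoint C D → (∀ c ∈ C, ∀ d ∈ D, ¬ G.Adj c d) → Separated G (insert v (A ∪ B)) := by
    intro C D hC hvC hCD hdCD h
    refine ⟨C, insert v D, hC, by simp, ?_, by rw [← hCD, Finset.union_insert], ?_⟩
    · rw [Finset.disjoint_insert_right]
      exact ⟨fun hvC => hv (hCD ▸ Finset.mem_union_left _ hvC), hdCD⟩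
    · intro c hc d hd
      rcases Finset.mem_insert.1 hd with rfl | hd
      · exact fun h => hvC c hc h.symm
      · exact h c hc d hd
  have hBA : ∀ b ∈ B, ∀ a ∈ A, ¬ G.Adj b a := fun b hb a ha h => hAB a ha b hb h.symm
  by_cases hvA : ∀ a ∈ A, ¬ G.Adj v a
  · exact key A B hA hvA rfl hd hAB
  by_cases hvB : ∀ b ∈ B, ¬ G.Adj v b
  · exact key B A hB hvB (Finset.union_comm _ _) hd.symm hBA
  push Not at hvA hvB
  obtain ⟨a, ha, hva⟩ := hvA
  obtain ⟨b, hb, hvb⟩ := hvB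
  rcases Finset.mem_union.1 hw with hw | hw
  · exact separated_insert_of_nonadj hG hv hd hAB hw hvw hb hvb
  · rw [Finset.union_comm] at hv ⊢
    exact separated_insert_of_nonadj hG hv hd.symm hBA hw hvw ha hva

/-- A set of at least two vertices of a `P₄`-free graph induces a graph that is disconnected
or has disconnected complement. -/
theorem separated_or_separated_compl {V : Type*} {G : SimpleGraph V} (hG : ¬ HasInducedP4 G)
    (S : Finset V) (hS : S.Nontrivial) : Separated G S ∨ Separated Gᶜ S := by
  induction S using Finset.induction_on with
  | empty => simp at hS
  | insert v S hv ih =>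
    by_cases hS' : S.Nontrivial
    · rcases ih hS' with h | h
      · exact separated_insert_or_compl hG hv h
      · have := separated_insert_or_compl (mt hasInducedP4_compl hG) hv h
        rwa [compl_compl, or_comm] at this
    · have hne : S.Nonempty := by
        by_contra h
        rw [Finset.not_nonempty_iff_eq_empty] at h
        simp [h] at hS
      obtain ⟨w, rfl⟩ | h := hne.exists_eq_singleton_or_nontrivial
      · have split : ∀ K : SimpleGraph V, ¬ K.Adj v w → Separated K (insert v {w}) :=
          fun K hK => ⟨{v}, {w}, by simp, by simp, by simpa using hv, rfl, by simpa using hK⟩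
        by_cases h : G.Adj v w
        · exact Or.inr (split _ fun h' => (SimpleGraph.compl_adj _ _ _ |>.1 h').2 h)
        · exact Or.inl (split _ h)
      · exact absurd h hS'

theorem exists_weights_of_mem_Ico {a b e : ℝ} (ha : a ∈ Set.Ico (0 : ℝ) 1)
    (hb : b ∈ Set.Ico (0 : ℝ) 1) (he : e = 0 ∨ e = 1) :
    ∃ s t c : ℝ, s + t = 1 ∧ s * a + t * e = c ∧ s * e + t * b = c ∧ c ∈ Set.Ico (0 : ℝ) 1 := by
  obtain ⟨ha0, ha1⟩ := ha
  obtain ⟨hb0, hb1⟩ := hb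
  rcases he with rfl | rfl
  · rcases ha0.eq_or_lt with rfl | ha0
    · exact ⟨1, 0, 0, by simp⟩
    · have hab : 0 < a + b := by linarith
      refine ⟨b / (a + b), a / (a + b), a * b / (a + b), by field_simp; ring, by field_simp; ring,
        by field_simp; ring, by positivity, ?_⟩
      rw [div_lt_one hab]
      nlinarith
  · have hab : 0 < 2 - a - b := by linarith
    refine ⟨(1 - b) / (2 - a - b), (1 - a) / (2 - a - b), (1 - a * b) / (2 - a - b),
      by field_simp; ring, by field_simp; ring, by field_simp; ring, ?_, ?_⟩
    · exact div_nonneg (by nlinarith) hab.le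
    · rw [div_lt_one hab]
      nlinarith

/-- Every nonempty vertex set `S` of a `P₄`-free graph carries a weight of total mass `1` which
the adjacency matrix of the induced subgraph maps to a constant `c ∈ [0, 1)`. -/
theorem exists_weight_on {V : Type*} [Fintype V] {G : SimpleGraph V}
    (hG : ¬ HasInducedP4 G) (S : Finset V) (hS : S.Nonempty) :
    ∃ (u : V → ℝ) (c : ℝ), (∀ i ∉ S, u i = 0) ∧ ∑ i, u i = 1 ∧
      (∀ i ∈ S, (G.adjMatrix ℝ).mulVec u i = c) ∧ c ∈ Set.Ico (0 : ℝ) 1 := by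
  induction S using Finset.strongInduction with
  | H S ih =>
  obtain ⟨v, rfl⟩ | hnt := hS.exists_eq_singleton_or_nontrivial
  · exact ⟨Pi.single v 1, 0, by simp +contextual, by simp, by simp, by simp⟩
  obtain ⟨A, B, hA, hB, hd, rfl, e, he, hAB⟩ : ∃ A B : Finset V, A.Nonempty ∧ B.Nonempty ∧
      Disjoint A B ∧ A ∪ B = S ∧ ∃ e : ℝ, (e = 0 ∨ e = 1) ∧
      ∀ a ∈ A, ∀ b ∈ B, G.adjMatrix ℝ a b = e := by
    rcases separated_or_separated_compl hG S hnt with h | h <;>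
      obtain ⟨A, B, hA, hB, hd, hS, h⟩ := h
    · exact ⟨A, B, hA, hB, hd, hS, 0, Or.inl rfl, fun a ha b hb => by simp [h a ha b hb]⟩
    · refine ⟨A, B, hA, hB, hd, hS, 1, Or.inr rfl, fun a ha b hb => ?_⟩
      have hne : a ≠ b := fun e => Finset.disjoint_left.1 hd ha (e ▸ hb)
      have := h a ha b hb
      simp_all [SimpleGraph.compl_adj]
  have hdis := Finset.disjoint_left.1 hd
  obtain ⟨u, a, hu0, hu1, hua, ha⟩ := ih A
    (Finset.subset_union_left.ssubset_of_ne fun e' => by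
      obtain ⟨b, hb⟩ := hB
      exact hdis (e' ▸ Finset.mem_union_right A hb) hb) hA
  obtain ⟨v, b, hv0, hv1, hvb, hb⟩ := ih B
    (Finset.subset_union_right.ssubset_of_ne fun e' => by
      obtain ⟨a, ha⟩ := hA
      exact hdis ha (e' ▸ Finset.mem_union_left B ha)) hB
  obtain ⟨s, t, c, hst, hc, hc', hcI⟩ := exists_weights_of_mem_Ico ha hb he
  have cross : ∀ (C : Finset V) (x : V → ℝ) (i : V), (∀ j ∉ C, x j = 0) → ∑ j, x j = 1 →
      (∀ j ∈ C, G.adjMatrix ℝ i j = e) → (G.adjMatrix ℝ).mulVec x i = e := by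
    intro C x i hx0 hx1 hi
    rw [← mul_one e, ← hx1, Finset.mul_sum, Matrix.mulVec, dotProduct]
    refine Finset.sum_congr rfl fun j _ => ?_
    by_cases hj : j ∈ C
    · rw [hi j hj]
    · simp [hx0 j hj]
  refine ⟨s • u + t • v, c, fun i hi => ?_, ?_, fun i hi => ?_, hcI⟩
  · rw [Finset.mem_union, not_or] at hi
    simp [hu0 i hi.1, hv0 i hi.2]
  · simp [Finset.sum_add_distrib, ← Finset.mul_sum, hu1, hv1, hst]
  · rw [Matrix.mulVec_add, Matrix.mulVec_smul, Matrix.mulVec_smul]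
    simp only [Pi.add_apply, Pi.smul_apply, smul_eq_mul]
    rcases Finset.mem_union.1 hi with hi | hi
    · rw [hua i hi, cross B v i hv0 hv1 (hAB i hi), hc]
    · rw [hvb i hi, cross A u i hu0 hu1 fun j hj => by
        rw [← hAB j hj i hi]; exact G.isSymm_adjMatrix.apply _ _, hc']

/-- A nonempty cograph has a weight of total mass `1` mapped by the adjacency matrix to a constant
`c ∈ [0, 1)`. -/
theorem IsCograph.exists_weight {V : Type*} [Fintype V] [Nonempty V] {G : SimpleGraph V}
    (hG : IsCograph G) : ∃ (u : V → ℝ) (c : ℝ), ∑ i, u i = 1 ∧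
      (G.adjMatrix ℝ).mulVec u = (fun _ => c) ∧ c < 1 ∧ 0 ≤ c := by
  obtain ⟨u, c, -, h1, hc, h0, hlt⟩ :=
    exists_weight_on hG.not_hasInducedP4 Finset.univ Finset.univ_nonempty
  exact ⟨u, c, h1, funext fun i => hc i (Finset.mem_univ i), hlt, h0⟩

open Matrix

/-- The quadratic form of a symmetric matrix in eigenvector coordinates. -/
theorem dotProduct_mulVec_eq_sum_eigenvalues {V : Type*} [Fintype V] {A : Matrix V V ℝ}
    (hA : A.IsHermitian) (x : V → ℝ) :
    x ⬝ᵥ A *ᵥ x = ∑ i, hA.eigenvalues i *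
      (star (hA.eigenvectorUnitary : Matrix V V ℝ) *ᵥ x) i ^ 2 := by
  set U := (hA.eigenvectorUnitary : Matrix V V ℝ)
  have h : A = U * diagonal hA.eigenvalues * star U := by
    conv_lhs => rw [hA.spectral_theorem]
    rfl
  have ht : star U = Uᵀ := by
    rw [star_eq_conjTranspose, conjTranspose_eq_transpose_of_trivial]
  conv_lhs => rw [h]
  rw [← mulVec_mulVec, ← mulVec_mulVec, dotProduct_mulVec, ← mulVec_transpose, ht]
  simp only [dotProduct, mulVec_diagonal]
  exact Finset.sum_congr rfl fun i _ => by ring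

/-- There is a linear system of rank at most the number of negative eigenvalues on whose kernel
the quadratic form is nonnegative. -/
theorem exists_nonneg_on_ker {V : Type*} [Fintype V] {A : Matrix V V ℝ} (hA : A.IsHermitian) :
    ∃ g : (V → ℝ) →ₗ[ℝ] ({i // hA.eigenvalues i < 0} → ℝ),
      ∀ x, g x = 0 → 0 ≤ x ⬝ᵥ A *ᵥ x := by
  refine ⟨LinearMap.funLeft ℝ ℝ Subtype.val ∘ₗ
    (star (hA.eigenvectorUnitary : Matrix V V ℝ)).mulVecLin, fun x hx => ?_⟩
  rw [dotProduct_mulVec_eq_sum_eigenvalues hA]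
  refine Finset.sum_nonneg fun i _ => ?_
  rcases lt_or_ge (hA.eigenvalues i) 0 with hi | hi
  · have : (star (hA.eigenvectorUnitary : Matrix V V ℝ) *ᵥ x) i = 0 := congrFun hx ⟨i, hi⟩
    simp [this]
  · positivity

/-- The negative eigenvectors parametrize a subspace on which the quadratic form is negative
definite. -/
theorem exists_negDef_param {V : Type*} [Fintype V] {A : Matrix V V ℝ} (hA : A.IsHermitian) :
    ∃ f : ({i // hA.eigenvalues i < 0} → ℝ) →ₗ[ℝ] (V → ℝ),
      ∀ y, y ≠ 0 → f y ⬝ᵥ A *ᵥ f y < 0 := by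
  refine ⟨(hA.eigenvectorUnitary : Matrix V V ℝ).mulVecLin ∘ₗ
    Function.ExtendByZero.linearMap ℝ Subtype.val, fun y hy => ?_⟩
  obtain ⟨i, hi⟩ := Function.ne_iff.1 hy
  have hz : ∀ j, ¬ hA.eigenvalues j < 0 → Function.extend Subtype.val y 0 j = 0 := fun j hj =>
    Function.extend_apply' _ _ _ fun ⟨a, ha⟩ => hj (ha ▸ a.2)
  rw [dotProduct_mulVec_eq_sum_eigenvalues hA]
  simp only [LinearMap.comp_apply, mulVecLin_apply, mulVec_mulVec, Unitary.coe_star_mul_self,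
    one_mulVec, Function.ExtendByZero.linearMap_apply]
  refine Finset.sum_neg' (fun j _ => ?_) ⟨i, Finset.mem_univ _, ?_⟩
  · by_cases hj : hA.eigenvalues j < 0
    · exact mul_nonpos_of_nonpos_of_nonneg hj.le (sq_nonneg _)
    · simp [hz j hj]
  · rw [Subtype.val_injective.extend_apply]
    exact mul_neg_of_neg_of_pos i.2 (by simpa [sq_pos_iff] using hi)

theorem finrank_le_of_neg_of_nonneg_on_ker {V W W' : Type*} [Fintype V]
    [AddCommGroup W] [Module ℝ W] [AddCommGroup W'] [Module ℝ W'] [Module.Finite ℝ W']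
    {A : Matrix V V ℝ} (f : W →ₗ[ℝ] (V → ℝ)) (hf : ∀ y, y ≠ 0 → f y ⬝ᵥ A *ᵥ f y < 0)
    (g : (V → ℝ) →ₗ[ℝ] W') (hg : ∀ x, g x = 0 → 0 ≤ x ⬝ᵥ A *ᵥ x) :
    Module.finrank ℝ W ≤ Module.finrank ℝ W' := by
  refine LinearMap.finrank_le_finrank_of_injective (f := g ∘ₗ f) ?_
  rw [injective_iff_map_eq_zero]
  intro y hy
  by_contra h
  exact (hf y h).not_ge (hg _ hy)

theorem card_neg_eigenvalues_eq_finrank {V W W' : Type*} [Fintype V]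
    [AddCommGroup W] [Module ℝ W] [AddCommGroup W'] [Module ℝ W'] [Module.Finite ℝ W']
    {A : Matrix V V ℝ} (hA : A.IsHermitian)
    (f : W →ₗ[ℝ] (V → ℝ)) (hf : ∀ y, y ≠ 0 → f y ⬝ᵥ A *ᵥ f y < 0)
    (g : (V → ℝ) →ₗ[ℝ] W') (hg : ∀ x, g x = 0 → 0 ≤ x ⬝ᵥ A *ᵥ x)
    (h : Module.finrank ℝ W' = Module.finrank ℝ W) :
    Fintype.card {i // hA.eigenvalues i < 0} = Module.finrank ℝ W := by
  obtain ⟨f', hf'⟩ := exists_negDef_param hA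
  obtain ⟨g', hg'⟩ := exists_nonneg_on_ker hA
  have h₁ := finrank_le_of_neg_of_nonneg_on_ker f' hf' g hg
  have h₂ := finrank_le_of_neg_of_nonneg_on_ker f hf g' hg'
  rw [Module.finrank_fintype_fun_eq_card] at h₁ h₂
  omega

theorem negCount_eq_card {V : Type*} [Fintype V] (G : SimpleGraph V) :
    negCount G = Fintype.card {i // (adjMatrix_isHermitian G).eigenvalues i < 0} := by
  rw [negCount, Fintype.card_subtype]

theorem adjMatrix_graphJoin {α β : Type*} (G : SimpleGraph α) (H : SimpleGraph β) :
    (graphJoin G H).adjMatrix ℝ =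
      fromBlocks (G.adjMatrix ℝ) (of fun _ _ => 1) (of fun _ _ => 1) (H.adjMatrix ℝ) := by
  ext (i | i) (j | j) <;> rw [SimpleGraph.adjMatrix_apply] <;> simp [graphJoin] <;> congr

theorem adjMatrix_sum {α β : Type*} (G : SimpleGraph α) (H : SimpleGraph β) :
    (G ⊕g H).adjMatrix ℝ = fromBlocks (G.adjMatrix ℝ) 0 0 (H.adjMatrix ℝ) := by
  ext (i | i) (j | j) <;> simp [SimpleGraph.adjMatrix_apply]

theorem dotProduct_adjMatrix_graphJoin_mulVec {α β : Type*} [Fintype α] [Fintype β]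
    (G : SimpleGraph α) (H : SimpleGraph β) (x : α → ℝ) (y : β → ℝ) :
    Sum.elim x y ⬝ᵥ (graphJoin G H).adjMatrix ℝ *ᵥ Sum.elim x y =
      x ⬝ᵥ G.adjMatrix ℝ *ᵥ x + y ⬝ᵥ H.adjMatrix ℝ *ᵥ y + 2 * (∑ i, x i) * ∑ j, y j := by
  rw [adjMatrix_graphJoin, fromBlocks_mulVec, sumElim_dotProduct_sumElim]
  simp only [Sum.elim_comp_inl, Sum.elim_comp_inr, dotProduct_add]
  simp only [dotProduct, mulVec, of_apply, one_mul, ← Finset.sum_mul]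
  ring

theorem dotProduct_adjMatrix_sum_mulVec {α β : Type*} [Fintype α] [Fintype β]
    (G : SimpleGraph α) (H : SimpleGraph β) (x : α → ℝ) (y : β → ℝ) :
    Sum.elim x y ⬝ᵥ (G ⊕g H).adjMatrix ℝ *ᵥ Sum.elim x y =
      x ⬝ᵥ G.adjMatrix ℝ *ᵥ x + y ⬝ᵥ H.adjMatrix ℝ *ᵥ y := by
  rw [adjMatrix_sum, fromBlocks_mulVec, sumElim_dotProduct_sumElim]
  simp

theorem dotProduct_mulVec_add_smul {V : Type*} [Fintype V] {A : Matrix V V ℝ} (hA : A.IsSymm)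
    {u : V → ℝ} {c : ℝ} (hu : ∑ i, u i = 1) (hc : A *ᵥ u = fun _ => c) (w : V → ℝ) (r : ℝ) :
    (w + r • u) ⬝ᵥ A *ᵥ (w + r • u) = w ⬝ᵥ A *ᵥ w + 2 * r * c * ∑ i, w i + r ^ 2 * c := by
  have hw : w ⬝ᵥ A *ᵥ u = c * ∑ i, w i := by
    rw [hc, dotProduct, ← Finset.sum_mul, mul_comm]
  have hw' : u ⬝ᵥ A *ᵥ w = c * ∑ i, w i := by
    rw [dotProduct_mulVec, ← mulVec_transpose, hA.eq, dotProduct_comm, hw]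
  have huu : u ⬝ᵥ A *ᵥ u = c := by
    rw [hc, dotProduct, ← Finset.sum_mul, hu, one_mul]
  simp only [mulVec_add, mulVec_smul, add_dotProduct, dotProduct_add, smul_dotProduct,
    dotProduct_smul, smul_eq_mul, hw, hw', huu]
  ring

theorem negCount_sum {α β : Type*} [Fintype α] [Fintype β] (G : SimpleGraph α)
    (H : SimpleGraph β) : negCount (G ⊕g H) = negCount G + negCount H := by
  obtain ⟨f₁, hf₁⟩ := exists_negDef_param (adjMatrix_isHermitian G)
  obtain ⟨f₂, hf₂⟩ := exists_negDef_param (adjMatrix_isHermitian H)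
  obtain ⟨g₁, hg₁⟩ := exists_nonneg_on_ker (adjMatrix_isHermitian G)
  obtain ⟨g₂, hg₂⟩ := exists_nonneg_on_ker (adjMatrix_isHermitian H)
  let f := (LinearEquiv.sumArrowLequivProdArrow α β ℝ ℝ).symm.toLinearMap ∘ₗ f₁.prodMap f₂
  let g := g₁.prodMap g₂ ∘ₗ (LinearEquiv.sumArrowLequivProdArrow α β ℝ ℝ).toLinearMap
  have key := card_neg_eigenvalues_eq_finrank (adjMatrix_isHermitian (G ⊕g H)) f ?_ g ?_ rfl
  · rw [negCount_eq_card, negCount_eq_card, negCount_eq_card, key]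
    simp only [Module.finrank_prod, Module.finrank_fintype_fun_eq_card]
  · rintro ⟨y₁, y₂⟩ hy
    change Sum.elim (f₁ y₁) (f₂ y₂) ⬝ᵥ _ *ᵥ Sum.elim (f₁ y₁) (f₂ y₂) < 0
    rw [dotProduct_adjMatrix_sum_mulVec]
    by_cases h₁ : y₁ = 0
    · have h₂ : y₂ ≠ 0 := fun h₂ => hy (by rw [h₁, h₂]; rfl)
      simpa [h₁] using hf₂ y₂ h₂
    · by_cases h₂ : y₂ = 0
      · simpa [h₂] using hf₁ y₁ h₁
      · exact add_neg (hf₁ y₁ h₁) (hf₂ y₂ h₂)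
  · intro x hx
    rw [← Sum.elim_comp_inl_inr x, dotProduct_adjMatrix_sum_mulVec]
    exact add_nonneg (hg₁ _ (congrArg Prod.fst hx)) (hg₂ _ (congrArg Prod.snd hx))

theorem negCount_graphJoin {α β : Type*} [Fintype α] [Fintype β] [Nonempty α] [Nonempty β]
    {G : SimpleGraph α} {H : SimpleGraph β} (hG : IsCograph G) (hH : IsCograph H) :
    negCount (graphJoin G H) = negCount G + negCount H + 1 := by
  obtain ⟨f₁, hf₁⟩ := exists_negDef_param (adjMatrix_isHermitian G)
  obtain ⟨f₂, hf₂⟩ := exists_negDef_param (adjMatrix_isHermitian H)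
  obtain ⟨g₁, hg₁⟩ := exists_nonneg_on_ker (adjMatrix_isHermitian G)
  obtain ⟨g₂, hg₂⟩ := exists_nonneg_on_ker (adjMatrix_isHermitian H)
  obtain ⟨u, a, hu, hua, ha1, ha0⟩ := hG.exists_weight
  obtain ⟨v, b, hv, hvb, hb1, hb0⟩ := hH.exists_weight
  let f : (_ × _ × ℝ) →ₗ[ℝ] (α ⊕ β → ℝ) :=
    { toFun := fun p => Sum.elim (f₁ p.1 + (p.2.2 - ∑ i, f₁ p.1 i) • u)
        (f₂ p.2.1 + (-p.2.2 - ∑ j, f₂ p.2.1 j) • v)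
      map_add' := fun p q => by
        ext (i | i) <;> simp [Finset.sum_add_distrib] <;> ring
      map_smul' := fun r p => by
        ext (i | i) <;> simp [← Finset.mul_sum] <;> ring }
  let g : (α ⊕ β → ℝ) →ₗ[ℝ] (_ × _ × ℝ) :=
    { toFun := fun x => (g₁ (x ∘ Sum.inl), g₂ (x ∘ Sum.inr),
        ∑ i, x (Sum.inl i) - ∑ j, x (Sum.inr j))
      map_add' := fun x y => by
        simp [Pi.add_comp, Finset.sum_add_distrib]; ring
      map_smul' := fun r x => by
        simp [Pi.smul_comp, ← Finset.mul_sum]; ring }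
  have key := card_neg_eigenvalues_eq_finrank (adjMatrix_isHermitian (graphJoin G H)) f ?_ g ?_ rfl
  · rw [negCount_eq_card, negCount_eq_card, negCount_eq_card, key]
    simp only [Module.finrank_prod, Module.finrank_fintype_fun_eq_card, Module.finrank_self,
      add_assoc]
  · rintro ⟨y₁, y₂, t⟩ hy
    change Sum.elim (f₁ y₁ + (t - ∑ i, f₁ y₁ i) • u) (f₂ y₂ + (-t - ∑ j, f₂ y₂ j) • v) ⬝ᵥ _ *ᵥ
      Sum.elim (f₁ y₁ + (t - ∑ i, f₁ y₁ i) • u) (f₂ y₂ + (-t - ∑ j, f₂ y₂ j) • v) < 0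
    rw [dotProduct_adjMatrix_graphJoin_mulVec,
      dotProduct_mulVec_add_smul G.isSymm_adjMatrix hu hua,
      dotProduct_mulVec_add_smul H.isSymm_adjMatrix hv hvb]
    simp only [Pi.add_apply, Pi.smul_apply, smul_eq_mul, Finset.sum_add_distrib,
      ← Finset.mul_sum, hu, hv]
    have h₁ : f₁ y₁ ⬝ᵥ G.adjMatrix ℝ *ᵥ f₁ y₁ ≤ 0 := by
      by_cases h : y₁ = 0
      · simp [h]
      · exact (hf₁ y₁ h).le
    have h₂ : f₂ y₂ ⬝ᵥ H.adjMatrix ℝ *ᵥ f₂ y₂ ≤ 0 := by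
      by_cases h : y₂ = 0
      · simp [h]
      · exact (hf₂ y₂ h).le
    have h₃ : f₁ y₁ ⬝ᵥ G.adjMatrix ℝ *ᵥ f₁ y₁ + f₂ y₂ ⬝ᵥ H.adjMatrix ℝ *ᵥ f₂ y₂
        - (2 - a - b) * t ^ 2 < 0 := by
      have hab : 0 < 2 - a - b := by linarith
      have ht := mul_nonneg hab.le (sq_nonneg t)
      by_cases hy₁ : y₁ = 0
      · by_cases hy₂ : y₂ = 0
        · have ht0 : t ≠ 0 := fun ht0 => hy (by rw [hy₁, hy₂, ht0]; rfl)
          have : 0 < (2 - a - b) * t ^ 2 := by positivity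
          linarith
        · linarith [hf₂ y₂ hy₂]
      · linarith [hf₁ y₁ hy₁]
    have h₄ := mul_nonneg ha0 (sq_nonneg (∑ i, f₁ y₁ i))
    have h₅ := mul_nonneg hb0 (sq_nonneg (∑ j, f₂ y₂ j))
    linarith
  · intro x hx
    have hs : ∑ i, x (Sum.inl i) = ∑ j, x (Sum.inr j) :=
      sub_eq_zero.1 (congrArg (fun p => p.2.2) hx)
    rw [← Sum.elim_comp_inl_inr x, dotProduct_adjMatrix_graphJoin_mulVec]
    have h₁ := hg₁ _ (congrArg Prod.fst hx)
    have h₂ := hg₂ _ (congrArg (fun p => p.2.1) hx)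
    simp only [Function.comp_apply, hs]
    nlinarith [sq_nonneg (∑ j, x (Sum.inr j))]

/-- For nonempty cographs `G` and `H`, the number of negative adjacency eigenvalues of
the join `G ⊗ H` is `n₋(G) + n₋(H) + 1`, and that of the disjoint union `G ∪ H` is
`n₋(G) + n₋(H)`. -/
theorem negCount_join_and_disjUnion {α β : Type*} [Fintype α] [Fintype β]
    [Nonempty α] [Nonempty β] (G : SimpleGraph α) (H : SimpleGraph β)
    (hG : IsCograph G) (hH : IsCograph H) :
    negCount (graphJoin G H) = negCount G + negCount H + 1 ∧
    negCount (G ⊕g H) = negCount G + negCount H := by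
  exact ⟨negCount_graphJoin hG hH, negCount_sum G H⟩
end
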